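/- For every real g ∈ (0, 1/4) and every integer m ≥ 1, the strict inequalities φ(W(g)−1)²·(W(g)−1)^m / W(g) < W_m(g) < (W(g)−1)^m hold, where φ(q) := ∏_{i=1}^∞ (1 − q^i) is Euler's function (the infinite product converges since 0 < W(g)−1 < 1). -/

import Mathlib

/-- The sequence `X_m(g)` defined by `X_0 = 1`, `X_{m+1} = 1/(1 - g X_m)`. -/
noncomputable def Xseq (g : ℝ) : ℕ → ℝ
  | 0 => 1
  | m + 1 => 1 / (1 - g * Xseq g m)

/-- The fixed-height partition functions `W_0(g) = 1`, `W_m(g) = X_m(g) - X_{m-1}(g)` for `m ≥ 1`. -/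
noncomputable def Wseq (g : ℝ) : ℕ → ℝ
  | 0 => 1
  | m + 1 => Xseq g (m + 1) - Xseq g m

/-- The tree partition function `W(g) = (1 - √(1-4g))/(2g)`. -/
noncomputable def Wfun (g : ℝ) : ℝ := (1 - Real.sqrt (1 - 4 * g)) / (2 * g)

/-- Euler's function `φ(q) = ∏_{i=1}^∞ (1 - q^i)`. -/
noncomputable def eulerPhi (q : ℝ) : ℝ := ∏' i : ℕ, (1 - q ^ (i + 1))

open Filter Topology in
theorem tendsto_prod_eulerPhi {q : ℝ} (hq0 : 0 ≤ q) (hq1 : q < 1) :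
    Tendsto (fun n ↦ ∏ i ∈ Finset.range n, (1 - q ^ (i + 1))) atTop (𝓝 (eulerPhi q)) := by
  refine Multipliable.tendsto_prod_tprod_nat ?_
  have hs : Summable fun n : ℕ ↦ ‖-q ^ (n + 1)‖ := by
    simpa [abs_of_nonneg hq0] using
      (summable_nat_add_iff 1).2 (summable_geometric_of_lt_one hq0 hq1)
  simpa [sub_eq_add_neg] using multipliable_one_add_of_summable hs

theorem eulerPhi_nonneg {q : ℝ} (hq0 : 0 ≤ q) (hq1 : q < 1) : 0 ≤ eulerPhi q :=
  ge_of_tendsto' (tendsto_prod_eulerPhi hq0 hq1) fun _ ↦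
    Finset.prod_nonneg fun _ _ ↦ sub_nonneg.2 (pow_le_one₀ hq0 hq1.le)

theorem eulerPhi_le_one_sub_sq {q : ℝ} (hq0 : 0 ≤ q) (hq1 : q < 1) :
    eulerPhi q ≤ 1 - q ^ 2 := by
  refine le_of_tendsto'
    ((Filter.tendsto_add_atTop_iff_nat 2).2 (tendsto_prod_eulerPhi hq0 hq1)) fun n ↦ ?_
  have hsq : 0 ≤ 1 - q ^ 2 := sub_nonneg.2 (pow_le_one₀ hq0 hq1.le)
  induction n with
  | zero =>
    simp only [Finset.prod_range_succ, Finset.prod_range_zero]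
    norm_num
    nlinarith
  | succ n ih =>
    rw [show n + 1 + 2 = (n + 2) + 1 by ring, Finset.prod_range_succ]
    refine (mul_le_of_le_one_right ?_ (sub_le_self _ (pow_nonneg hq0 _))).trans ih
    exact Finset.prod_nonneg fun _ _ ↦ sub_nonneg.2 (pow_le_one₀ hq0 hq1.le)

/-- For `g ∈ (0,1/4)` the number `q = W(g) - 1` lies in `(0,1)` and uniformizes
`g = q / (1 + q)²`. -/
theorem Wfun_sub_one_spec {g : ℝ} (hg0 : 0 < g) (hg1 : g < 1/4) :
    0 < Wfun g - 1 ∧ Wfun g - 1 < 1 ∧ g = (Wfun g - 1) / (1 + (Wfun g - 1)) ^ 2 := by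
  obtain ⟨s, hs⟩ : ∃ s, s = √(1 - 4 * g) := ⟨_, rfl⟩
  have hs0 : 0 < s := hs ▸ Real.sqrt_pos.2 (by linarith)
  have hsq : s ^ 2 = 1 - 4 * g := hs ▸ Real.sq_sqrt (by linarith)
  have hs1 : s < 1 := by nlinarith
  have hg : g = (1 - s) * (1 + s) / 4 := by linarith
  have hW : Wfun g = 2 / (1 + s) := by
    rw [Wfun, ← hs, hg]
    have : 1 - s ≠ 0 := by linarith
    have : 1 + s ≠ 0 := by linarith
    field_simp
    norm_num
  rw [hW]
  refine ⟨?_, ?_, ?_⟩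
  · rw [sub_pos, lt_div_iff₀ (by linarith)]; linarith
  · rw [sub_lt_iff_lt_add, div_lt_iff₀ (by linarith)]; linarith
  · have : 1 + s ≠ 0 := by linarith
    rw [add_sub_cancel, hg]
    field_simp
    ring

theorem Xseq_uniformized {q : ℝ} (hq0 : 0 < q) (hq1 : q < 1) (m : ℕ) :
    Xseq (q / (1 + q) ^ 2) m = (1 + q) * (1 - q ^ (m + 1)) / (1 - q ^ (m + 2)) := by
  have hpos (k : ℕ) : 1 - q ^ (k + 1) ≠ 0 :=
    (sub_pos.2 (pow_lt_one₀ hq0.le hq1 k.succ_ne_zero)).ne'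
  induction m with
  | zero =>
    rw [Xseq, eq_div_iff (hpos 1)]
    ring
  | succ m ih =>
    have h2 := hpos (m + 1)
    have h3 := hpos (m + 2)
    have hq : 1 + q ≠ 0 := by positivity
    have key : 1 - q / (1 + q) ^ 2 * ((1 + q) * (1 - q ^ (m + 1)) / (1 - q ^ (m + 2))) =
        (1 - q ^ (m + 3)) / ((1 + q) * (1 - q ^ (m + 2))) := by
      rw [eq_div_iff (mul_ne_zero hq h2)]
      field_simp
      ring
    rw [Xseq, ih, key, one_div_div]

theorem Wseq_uniformized {q : ℝ} (hq0 : 0 < q) (hq1 : q < 1) {m : ℕ} (hm : 1 ≤ m) :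
    Wseq (q / (1 + q) ^ 2) m =
      (1 + q) * (1 - q) ^ 2 * q ^ m / ((1 - q ^ (m + 1)) * (1 - q ^ (m + 2))) := by
  obtain ⟨m, rfl⟩ := Nat.exists_eq_add_of_le' hm
  have hpos (k : ℕ) : 1 - q ^ (k + 1) ≠ 0 :=
    (sub_pos.2 (pow_lt_one₀ hq0.le hq1 k.succ_ne_zero)).ne'
  have h2 := hpos (m + 1)
  have h3 := hpos (m + 2)
  rw [Wseq, Xseq_uniformized hq0 hq1, Xseq_uniformized hq0 hq1, div_sub_div _ _ h3 h2,
    div_eq_div_iff (mul_ne_zero h3 h2) (mul_ne_zero h2 h3)]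
  ring

/-- For `g ∈ (0,1/4)` and `m ≥ 1`,
`φ(W(g)-1)²·(W(g)-1)^m / W(g) < W_m(g) < (W(g)-1)^m`. -/
theorem stmt_6 (g : ℝ) (hg0 : 0 < g) (hg1 : g < 1/4) (m : ℕ) (hm : 1 ≤ m) :
    eulerPhi (Wfun g - 1) ^ 2 * (Wfun g - 1) ^ m / Wfun g < Wseq g m ∧
    Wseq g m < (Wfun g - 1) ^ m := by
  obtain ⟨hq0, hq1, hg⟩ := Wfun_sub_one_spec hg0 hg1
  obtain ⟨q, hq⟩ : ∃ q, q = Wfun g - 1 := ⟨_, rfl⟩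
  have hW : Wfun g = 1 + q := by linarith
  rw [← hq] at hq0 hq1 hg
  rw [← hq, hW, hg, Wseq_uniformized hq0 hq1 hm]
  have hqm : 0 < q ^ m := pow_pos hq0 m
  have ha : q ^ (m + 1) ≤ q ^ 2 := pow_le_pow_of_le_one hq0.le hq1.le (by lia)
  have hb : q ^ (m + 2) < q ^ 2 := pow_lt_pow_right_of_lt_one₀ hq0 hq1 (by lia)
  have ha0 : 0 < q ^ (m + 1) := pow_pos hq0 _
  have hb0 : 0 < q ^ (m + 2) := pow_pos hq0 _
  have hqq : q ^ 2 < q := by nlinarith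
  have hA : 0 < 1 - q ^ (m + 1) := by linarith
  have hB : 0 < 1 - q ^ (m + 2) := by linarith
  have hAB : (1 - q ^ (m + 1)) * (1 - q ^ (m + 2)) < 1 :=
    mul_lt_one_of_nonneg_of_lt_one_left hA.le (by linarith) (by linarith)
  constructor
  · have hphi : eulerPhi q ^ 2 ≤ (1 - q ^ 2) ^ 2 :=
      pow_le_pow_left₀ (eulerPhi_nonneg hq0.le hq1) (eulerPhi_le_one_sub_sq hq0.le hq1) 2
    calc eulerPhi q ^ 2 * q ^ m / (1 + q)
        ≤ (1 - q ^ 2) ^ 2 * q ^ m / (1 + q) := by gcongr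
      _ = (1 + q) * (1 - q) ^ 2 * q ^ m := by
        field_simp
        ring
      _ < _ := by
        have : 0 < 1 - q := by linarith
        rw [lt_div_iff₀ (mul_pos hA hB)]
        exact mul_lt_of_lt_one_right (by positivity) hAB
  · rw [div_lt_iff₀ (mul_pos hA hB), mul_comm (q ^ m)]
    refine mul_lt_mul_of_pos_right ?_ hqm
    calc (1 + q) * (1 - q) ^ 2 = (1 - q) * (1 - q ^ 2) := by ring
      _ < (1 - q ^ (m + 1)) * (1 - q ^ (m + 2)) :=
        mul_lt_mul'' (by linarith) (by linarith) (by linarith) (by linarith)
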